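/- Suppose Θ̄ = −Θ. For all m₁, m₂, n₁, n₂ ∈ ℕ with n₁ ≥ m₁ and n₂ ≥ m₂, the product state b^{(4)}_{m,n}(q¹,π¹,q²,π²) = f_{m₁,n₁}(q¹,π¹) f_{m₂,n₂}(q²,π²) is a right star-eigenfunction of the full Hamiltonian H: H ⋆ b^{(4)}_{m,n} = E^R_{m,0} b^{(4)}_{m,n} with E^R_{m,0} = ħ(1 + Θ²/(4ħ²))(m₁ + m₂ + 1). -/

import Mathlib

open Complex Real

/-- Phase-space functions on ℝ⁴ with coordinates (q¹, π¹, q², π²). -/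
abbrev PhaseFn := ℝ → ℝ → ℝ → ℝ → ℂ

/-- Partial derivative with respect to q¹. -/
noncomputable def pdQ1 (F : PhaseFn) : PhaseFn :=
  fun q1 p1 q2 p2 => deriv (fun t => F t p1 q2 p2) q1

/-- Partial derivative with respect to π¹. -/
noncomputable def pdP1 (F : PhaseFn) : PhaseFn :=
  fun q1 p1 q2 p2 => deriv (fun t => F q1 t q2 p2) p1

/-- Partial derivative with respect to q². -/
noncomputable def pdQ2 (F : PhaseFn) : PhaseFn :=
  fun q1 p1 q2 p2 => deriv (fun t => F q1 p1 t p2) q2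

/-- Partial derivative with respect to π². -/
noncomputable def pdP2 (F : PhaseFn) : PhaseFn :=
  fun q1 p1 q2 p2 => deriv (fun t => F q1 p1 q2 t) p2

/-- The family (∂_{q^l})_{l=1,2}. -/
noncomputable def dQ : Fin 2 → PhaseFn → PhaseFn := ![pdQ1, pdQ2]

/-- The family (∂_{π^l})_{l=1,2}. -/
noncomputable def dP : Fin 2 → PhaseFn → PhaseFn := ![pdP1, pdP2]

/-- First-order bidifferential operator
`P₁(f,g) = Σ_l (∂_{q^l} f ∂_{π^l} g − ∂_{π^l} f ∂_{q^l} g)`. -/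
noncomputable def P1 (F G : PhaseFn) : PhaseFn :=
  fun q1 p1 q2 p2 =>
    ∑ l : Fin 2,
      (dQ l F q1 p1 q2 p2 * dP l G q1 p1 q2 p2 -
        dP l F q1 p1 q2 p2 * dQ l G q1 p1 q2 p2)

/-- Second-order bidifferential operator
`P₂(f,g) = Σ_{l,l'} (∂_{q^l}∂_{q^{l'}} f ∂_{π^l}∂_{π^{l'}} g
  − 2 ∂_{q^l}∂_{π^{l'}} f ∂_{π^l}∂_{q^{l'}} g + ∂_{π^l}∂_{π^{l'}} f ∂_{q^l}∂_{q^{l'}} g)`. -/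
noncomputable def P2 (F G : PhaseFn) : PhaseFn :=
  fun q1 p1 q2 p2 =>
    ∑ l : Fin 2, ∑ l' : Fin 2,
      (dQ l (dQ l' F) q1 p1 q2 p2 * dP l (dP l' G) q1 p1 q2 p2 -
        2 * dQ l (dP l' F) q1 p1 q2 p2 * dP l (dQ l' G) q1 p1 q2 p2 +
        dP l (dP l' F) q1 p1 q2 p2 * dQ l (dQ l' G) q1 p1 q2 p2)

/-- Moyal star product, truncated (exactly) at second order:
valid when one factor is a polynomial of degree ≤ 2, in which case
`f ⋆ g = fg + (iℏ/2)P₁(f,g) + (1/2)(iℏ/2)² P₂(f,g)`. -/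
noncomputable def moyal (ℏ : ℝ) (F G : PhaseFn) : PhaseFn :=
  fun q1 p1 q2 p2 =>
    F q1 p1 q2 p2 * G q1 p1 q2 p2 +
      (Complex.I * (ℏ : ℂ) / 2) * P1 F G q1 p1 q2 p2 +
      (1 / 2) * (Complex.I * (ℏ : ℂ) / 2) ^ 2 * P2 F G q1 p1 q2 p2

/-- `H₀ = ½((q¹)² + (q²)² + (π¹)² + (π²)²)`. -/
noncomputable def H0 : PhaseFn :=
  fun q1 p1 q2 p2 => (((q1 ^ 2 + q2 ^ 2 + p1 ^ 2 + p2 ^ 2) / 2 : ℝ) : ℂ)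

/-- `H_L = −((Θ+Θ̄)/2ℏ)(q¹π² − q²π¹)`. -/
noncomputable def HL (ℏ Θ Θbar : ℝ) : PhaseFn :=
  fun q1 p1 q2 p2 => ((-((Θ + Θbar) / (2 * ℏ)) * (q1 * p2 - q2 * p1) : ℝ) : ℂ)

/-- `H_q = (Θ̄²/8ℏ²)((q¹)² + (q²)²)`. -/
noncomputable def Hq (ℏ Θbar : ℝ) : PhaseFn :=
  fun q1 p1 q2 p2 => ((Θbar ^ 2 / (8 * ℏ ^ 2) * (q1 ^ 2 + q2 ^ 2) : ℝ) : ℂ)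

/-- `H_π = (Θ²/8ℏ²)((π¹)² + (π²)²)`. -/
noncomputable def Hpi (ℏ Θ : ℝ) : PhaseFn :=
  fun q1 p1 q2 p2 => ((Θ ^ 2 / (8 * ℏ ^ 2) * (p1 ^ 2 + p2 ^ 2) : ℝ) : ℂ)

/-- Generalized Laguerre polynomial
`L_m^α(x) = Σ_{k=0}^{m} (Γ(m+α+1)/Γ(k+α+1)) (−x)^k/(k!(m−k)!)` (natural α). -/
noncomputable def genLaguerre (m α : ℕ) (x : ℝ) : ℝ :=
  ∑ k ∈ Finset.range (m + 1),
    (Real.Gamma ((m : ℝ) + α + 1) / Real.Gamma ((k : ℝ) + α + 1)) * (-x) ^ k /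
      ((k.factorial : ℝ) * ((m - k).factorial : ℝ))

/-- Wigner eigenfunction
`f_{m,n}(q,π) = 2(−1)^m √(m!/n!) (2/ℏ)^{(n−m)/2} (q+iπ)^{n−m}
  L_m^{n−m}(2(q²+π²)/ℏ) e^{−(q²+π²)/ℏ}` (for n ≥ m). -/
noncomputable def wignerF (ℏ : ℝ) (m n : ℕ) (q p : ℝ) : ℂ :=
  2 * (-1) ^ m * (Real.sqrt ((m.factorial : ℝ) / (n.factorial : ℝ)) : ℂ) *
    ((Real.sqrt (2 / ℏ) : ℂ)) ^ (n - m) * ((q : ℂ) + Complex.I * (p : ℂ)) ^ (n - m) *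
    ((genLaguerre m (n - m) (2 * (q ^ 2 + p ^ 2) / ℏ) : ℝ) : ℂ) *
    (Real.exp (-(q ^ 2 + p ^ 2) / ℏ) : ℂ)

/-- Product state `b⁴_{m,n}(q¹,π¹,q²,π²) = f_{m₁,n₁}(q¹,π¹) f_{m₂,n₂}(q²,π²)`. -/
noncomputable def b4 (ℏ : ℝ) (m1 n1 m2 n2 : ℕ) : PhaseFn :=
  fun q1 p1 q2 p2 => wignerF ℏ m1 n1 q1 p1 * wignerF ℏ m2 n2 q2 p2

/-- Coefficients of the generalized Laguerre polynomial. -/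
noncomputable def laguerreCoeff (m α k : ℕ) : ℂ :=
  if k ≤ m then
    ((m + α).factorial : ℂ) / ((k + α).factorial : ℂ) * (-1) ^ k /
      ((k.factorial : ℂ) * ((m - k).factorial : ℂ))
  else 0

/-- The generalized Laguerre polynomial as an element of `ℂ[X]`. -/
noncomputable def laguerrePoly (m α : ℕ) : Polynomial ℂ :=
  ∑ k ∈ Finset.range (m + 1), Polynomial.monomial k (laguerreCoeff m α k)

theorem coeff_laguerrePoly (m α k : ℕ) :
    (laguerrePoly m α).coeff k = laguerreCoeff m α k := by
  simp only [laguerrePoly, Polynomial.finsetSum_coeff, Polynomial.coeff_monomial,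
    Finset.sum_ite_eq', Finset.mem_range, Nat.lt_succ_iff]
  by_cases h : k ≤ m <;> simp [laguerreCoeff, h]

theorem laguerreCoeff_succ (m α k : ℕ) :
    laguerreCoeff m α (k + 1) * ((k : ℂ) + 1) * ((k : ℂ) + α + 1) =
      ((k : ℂ) - m) * laguerreCoeff m α k := by
  rcases lt_trichotomy k m with h | rfl | h
  · obtain ⟨d, rfl⟩ := Nat.exists_eq_add_of_lt h
    have hd : k + d + 1 - k = d + 1 := by omega
    have hd' : k + d + 1 - (k + 1) = d := by omega
    have hk : k + 1 + α = (k + α) + 1 := by omega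
    have hle : k ≤ k + d + 1 := by omega
    have hle' : k + 1 ≤ k + d + 1 := by omega
    simp only [laguerreCoeff, if_pos hle, if_pos hle', hd, hd', hk, Nat.factorial_succ]
    have e1 : ((k + α).factorial : ℂ) ≠ 0 := by exact_mod_cast Nat.factorial_ne_zero _
    have e2 : (k.factorial : ℂ) ≠ 0 := by exact_mod_cast Nat.factorial_ne_zero _
    have e3 : (d.factorial : ℂ) ≠ 0 := by exact_mod_cast Nat.factorial_ne_zero _
    have e4 : (k : ℂ) + 1 ≠ 0 := by exact_mod_cast Nat.succ_ne_zero k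
    have e5 : (d : ℂ) + 1 ≠ 0 := by exact_mod_cast Nat.succ_ne_zero d
    have e6 : (k : ℂ) + α + 1 ≠ 0 := by exact_mod_cast Nat.succ_ne_zero (k + α)
    push_cast
    field_simp
    ring
  · simp [laguerreCoeff]
  · have : ¬ k ≤ m := by omega
    have h' : ¬ k + 1 ≤ m := by omega
    simp [laguerreCoeff, this, h']

/-- Laguerre's differential equation. -/
theorem laguerrePoly_ode (m α : ℕ) (x : ℂ) :
    x * (laguerrePoly m α).derivative.derivative.eval x +
      ((α : ℂ) + 1 - x) * (laguerrePoly m α).derivative.eval x +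
      (m : ℂ) * (laguerrePoly m α).eval x = 0 := by
  have h : Polynomial.X * (laguerrePoly m α).derivative.derivative +
      Polynomial.C ((α : ℂ) + 1) * (laguerrePoly m α).derivative -
      Polynomial.X * (laguerrePoly m α).derivative +
      Polynomial.C (m : ℂ) * laguerrePoly m α = 0 := by
    ext k
    have hk := laguerreCoeff_succ m α k
    cases k with
    | zero =>
      simp only [Polynomial.coeff_add, Polynomial.coeff_sub, Polynomial.coeff_C_mul,
        Polynomial.coeff_X_mul_zero, Polynomial.coeff_derivative, coeff_laguerrePoly,
        Polynomial.coeff_zero]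
      push_cast at hk ⊢
      linear_combination hk
    | succ k =>
      simp only [Polynomial.coeff_add, Polynomial.coeff_sub, Polynomial.coeff_C_mul,
        Polynomial.coeff_X_mul, Polynomial.coeff_derivative, coeff_laguerrePoly,
        Polynomial.coeff_zero]
      push_cast at hk ⊢
      linear_combination hk
  have he := congrArg (Polynomial.eval x) h
  simp only [Polynomial.eval_add, Polynomial.eval_sub, Polynomial.eval_mul, Polynomial.eval_X,
    Polynomial.eval_C, Polynomial.eval_zero] at he
  linear_combination he

theorem eval_laguerrePoly (m α : ℕ) (x : ℝ) :
    (laguerrePoly m α).eval (x : ℂ) = (genLaguerre m α x : ℂ) := by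
  simp only [laguerrePoly, genLaguerre, Polynomial.eval_finsetSum, Polynomial.eval_monomial]
  push_cast
  refine Finset.sum_congr rfl fun k hk => ?_
  have hk' : k ≤ m := Nat.lt_succ_iff.mp (Finset.mem_range.mp hk)
  have hG : ∀ j : ℕ, Real.Gamma ((j : ℝ) + α + 1) = ((j + α).factorial : ℝ) := fun j => by
    rw [← Real.Gamma_nat_eq_factorial]
    push_cast
    rfl
  rw [hG, hG, laguerreCoeff, if_pos hk', neg_pow (x : ℂ) k]
  push_cast
  ring

/-- The function `A(q + iπ) B(2(q² + π²)/ℏ) exp(-(q² + π²)/ℏ)` for polynomials `A`, `B`. -/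
noncomputable def polyGauss (ℏ : ℝ) (A B : Polynomial ℂ) (q p : ℝ) : ℂ :=
  A.eval ((q : ℂ) + Complex.I * p) * B.eval (2 * ((q : ℂ) ^ 2 + (p : ℂ) ^ 2) / ℏ) *
    Complex.exp (-((q : ℂ) ^ 2 + (p : ℂ) ^ 2) / ℏ)

theorem hasDerivAt_polyGauss_left (ℏ : ℝ) (A B : Polynomial ℂ) (q p : ℝ) :
    HasDerivAt (fun t => polyGauss ℏ A B t p)
      (polyGauss ℏ A.derivative B q p +
        (2 * q / ℏ) * polyGauss ℏ A (2 * B.derivative - B) q p) q := by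
  have hq : HasDerivAt (fun t : ℝ => (t : ℂ)) 1 q := Complex.ofRealCLM.hasDerivAt
  have hs : HasDerivAt (fun t : ℝ => (t : ℂ) ^ 2 + (p : ℂ) ^ 2) (2 * q) q := by
    simpa using (hq.pow 2).add_const ((p : ℂ) ^ 2)
  have hA := (A.hasDerivAt ((q : ℂ) + Complex.I * p)).comp q (hq.add_const (Complex.I * p))
  have hB := (B.hasDerivAt (2 * ((q : ℂ) ^ 2 + (p : ℂ) ^ 2) / ℏ)).comp q
    ((hs.const_mul 2).div_const (ℏ : ℂ))
  refine ((hA.mul hB).mul (hs.neg.div_const (ℏ : ℂ)).cexp).congr_deriv ?_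
  simp only [polyGauss, Function.comp_apply, Pi.mul_apply, Pi.neg_apply, Polynomial.eval_sub,
    Polynomial.eval_mul, Polynomial.eval_ofNat]
  ring

theorem hasDerivAt_polyGauss_right (ℏ : ℝ) (A B : Polynomial ℂ) (q p : ℝ) :
    HasDerivAt (fun t => polyGauss ℏ A B q t)
      (Complex.I * polyGauss ℏ A.derivative B q p +
        (2 * p / ℏ) * polyGauss ℏ A (2 * B.derivative - B) q p) p := by
  have hp : HasDerivAt (fun t : ℝ => (t : ℂ)) 1 p := Complex.ofRealCLM.hasDerivAt
  have hs : HasDerivAt (fun t : ℝ => (q : ℂ) ^ 2 + (t : ℂ) ^ 2) (2 * p) p := by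
    simpa using (hp.pow 2).const_add ((q : ℂ) ^ 2)
  have hA := (A.hasDerivAt ((q : ℂ) + Complex.I * p)).comp p
    ((hp.const_mul Complex.I).const_add (q : ℂ))
  have hB := (B.hasDerivAt (2 * ((q : ℂ) ^ 2 + (p : ℂ) ^ 2) / ℏ)).comp p
    ((hs.const_mul 2).div_const (ℏ : ℂ))
  refine ((hA.mul hB).mul (hs.neg.div_const (ℏ : ℂ)).cexp).congr_deriv ?_
  simp only [polyGauss, Function.comp_apply, Pi.mul_apply, Pi.neg_apply, Polynomial.eval_sub,
    Polynomial.eval_mul, Polynomial.eval_ofNat]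
  ring

theorem deriv_deriv_polyGauss_left (ℏ : ℝ) (A B : Polynomial ℂ) (q p : ℝ) :
    deriv (fun s => deriv (fun t => polyGauss ℏ A B t p) s) q =
      polyGauss ℏ A.derivative.derivative B q p +
        (4 * q / ℏ) * polyGauss ℏ A.derivative (2 * B.derivative - B) q p +
        (2 / ℏ) * polyGauss ℏ A (2 * B.derivative - B) q p +
        (2 * q / ℏ) ^ 2 * polyGauss ℏ A
          (2 * (2 * B.derivative - B).derivative - (2 * B.derivative - B)) q p := by
  have hq : HasDerivAt (fun t : ℝ => (t : ℂ)) 1 q := Complex.ofRealCLM.hasDerivAt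
  have h := (hasDerivAt_polyGauss_left ℏ A.derivative B q p).add
    (((hq.const_mul 2).div_const (ℏ : ℂ)).mul
      (hasDerivAt_polyGauss_left ℏ A (2 * B.derivative - B) q p))
  simp_rw [fun s => (hasDerivAt_polyGauss_left ℏ A B s p).deriv]
  refine (h.congr_deriv ?_).deriv
  ring

theorem deriv_deriv_polyGauss_right (ℏ : ℝ) (A B : Polynomial ℂ) (q p : ℝ) :
    deriv (fun s => deriv (fun t => polyGauss ℏ A B q t) s) p =
      -polyGauss ℏ A.derivative.derivative B q p +
        (4 * Complex.I * p / ℏ) * polyGauss ℏ A.derivative (2 * B.derivative - B) q p +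
        (2 / ℏ) * polyGauss ℏ A (2 * B.derivative - B) q p +
        (2 * p / ℏ) ^ 2 * polyGauss ℏ A
          (2 * (2 * B.derivative - B).derivative - (2 * B.derivative - B)) q p := by
  have hp : HasDerivAt (fun t : ℝ => (t : ℂ)) 1 p := Complex.ofRealCLM.hasDerivAt
  have h := ((hasDerivAt_polyGauss_right ℏ A.derivative B q p).const_mul Complex.I).add
    (((hp.const_mul 2).div_const (ℏ : ℂ)).mul
      (hasDerivAt_polyGauss_right ℏ A (2 * B.derivative - B) q p))
  simp_rw [fun s => (hasDerivAt_polyGauss_right ℏ A B q s).deriv]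
  refine (h.congr_deriv ?_).deriv
  linear_combination polyGauss ℏ A.derivative.derivative B q p * Complex.I_mul_I

theorem exists_wignerF_eq (ℏ : ℝ) (m n : ℕ) :
    ∃ c : ℂ, ∀ q p : ℝ, wignerF ℏ m n q p =
      c * polyGauss ℏ (Polynomial.X ^ (n - m)) (laguerrePoly m (n - m)) q p := by
  refine ⟨2 * (-1) ^ m * (Real.sqrt ((m.factorial : ℝ) / (n.factorial : ℝ)) : ℂ) *
    ((Real.sqrt (2 / ℏ) : ℂ)) ^ (n - m), fun q p => ?_⟩
  have h : (2 * ((q : ℂ) ^ 2 + (p : ℂ) ^ 2) / ℏ) = ((2 * (q ^ 2 + p ^ 2) / ℏ : ℝ) : ℂ) := by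
    push_cast
    rfl
  rw [polyGauss, h, eval_laguerrePoly, wignerF]
  simp only [Polynomial.eval_pow, Polynomial.eval_X]
  push_cast
  ring

/-- The two-dimensional oscillator acts on `f_{m,n}` from the left with eigenvalue `ℏ(m + ½)`. -/
theorem oscillator_star_wignerF {ℏ : ℝ} (hℏ : ℏ ≠ 0) (m n : ℕ) (q p : ℝ) :
    ((q : ℂ) ^ 2 + (p : ℂ) ^ 2) / 2 * wignerF ℏ m n q p +
      Complex.I * ℏ / 2 * (q * deriv (fun t => wignerF ℏ m n q t) p -
        p * deriv (fun t => wignerF ℏ m n t p) q) -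
      (ℏ : ℂ) ^ 2 / 8 * (deriv (fun s => deriv (fun t => wignerF ℏ m n q t) s) p +
        deriv (fun s => deriv (fun t => wignerF ℏ m n t p) s) q) =
      ℏ * ((m : ℂ) + 1 / 2) * wignerF ℏ m n q p := by
  obtain ⟨c, hc⟩ := exists_wignerF_eq ℏ m n
  have hℏ' : (ℏ : ℂ) ≠ 0 := Complex.ofReal_ne_zero.mpr hℏ
  simp only [hc, deriv_const_mul_field, deriv_deriv_polyGauss_left, deriv_deriv_polyGauss_right]
  simp only [(hasDerivAt_polyGauss_left _ _ _ _ _).deriv,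
    (hasDerivAt_polyGauss_right _ _ _ _ _).deriv]
  have hA : ((q : ℂ) + Complex.I * p) *
      (Polynomial.X ^ (n - m) : Polynomial ℂ).derivative.eval ((q : ℂ) + Complex.I * p) =
      ((n - m : ℕ) : ℂ) *
        (Polynomial.X ^ (n - m) : Polynomial ℂ).eval ((q : ℂ) + Complex.I * p) := by
    rcases Nat.eq_zero_or_pos (n - m) with h | h
    · simp [h]
    · obtain ⟨k, hk⟩ := Nat.exists_eq_add_of_lt h
      rw [hk]
      simp
      ring
  have hL := laguerrePoly_ode m (n - m) (2 * ((q : ℂ) ^ 2 + (p : ℂ) ^ 2) / ℏ)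
  generalize (Polynomial.X ^ (n - m) : Polynomial ℂ) = A at *
  generalize laguerrePoly m (n - m) = B at *
  have hd2 : Polynomial.derivative (2 : Polynomial ℂ) = 0 := Polynomial.derivative_ofNat 2
  simp only [polyGauss, Polynomial.derivative_sub, Polynomial.derivative_mul, hd2,
    Polynomial.eval_sub, Polynomial.eval_add, Polynomial.eval_mul, Polynomial.eval_ofNat,
    Polynomial.eval_zero]
  generalize Polynomial.eval _ A = a at *
  generalize Polynomial.eval _ A.derivative = a1 at *
  generalize Polynomial.eval _ A.derivative.derivative = a2 at *
  generalize Polynomial.eval _ B = b at *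
  generalize Polynomial.eval _ B.derivative = b1 at *
  generalize Polynomial.eval _ B.derivative.derivative = b2 at *
  generalize Complex.exp _ = e
  have hL' : 2 * ((q : ℂ) ^ 2 + (p : ℂ) ^ 2) * b2 +
      ((((n - m : ℕ) : ℂ) + 1) * ℏ - 2 * ((q : ℂ) ^ 2 + (p : ℂ) ^ 2)) * b1 + m * ℏ * b = 0 := by
    field_simp at hL
    linear_combination hL
  linear_combination (norm := (field_simp; ring)) (-ℏ * b1 * e * c) * hA - a * e * c * hL' +
    (ℏ / 2 * q * a1 * b * e * c) * Complex.I_mul_I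

/-- The isotropic quadratic form on phase space with coefficient `K`. -/
noncomputable def isoQuad (K : ℂ) : PhaseFn :=
  fun q1 p1 q2 p2 => K * ((q1 : ℂ) ^ 2 + (p1 : ℂ) ^ 2 + (q2 : ℂ) ^ 2 + (p2 : ℂ) ^ 2)

theorem deriv_ofReal_sq (x : ℝ) : deriv (fun t : ℝ => (t : ℂ) ^ 2) x = 2 * x := by
  have h : HasDerivAt (fun t : ℝ => (t : ℂ)) 1 x := Complex.ofRealCLM.hasDerivAt
  have h2 : HasDerivAt (fun t : ℝ => (t : ℂ) ^ 2) (2 * x) x := by simpa using h.fun_pow 2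
  exact h2.deriv

theorem deriv_ofReal_id (x : ℝ) : deriv (fun t : ℝ => (t : ℂ)) x = 1 :=
  Complex.ofRealCLM.hasDerivAt.deriv

theorem pdQ1_isoQuad (K : ℂ) : pdQ1 (isoQuad K) = fun (q1 : ℝ) _ _ _ => K * (2 * q1) := by
  funext q1 p1 q2 p2
  simp [pdQ1, isoQuad, deriv_ofReal_sq]

theorem pdP1_isoQuad (K : ℂ) : pdP1 (isoQuad K) = fun _ (p1 : ℝ) _ _ => K * (2 * p1) := by
  funext q1 p1 q2 p2
  simp [pdP1, isoQuad, deriv_ofReal_sq]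

theorem pdQ2_isoQuad (K : ℂ) : pdQ2 (isoQuad K) = fun _ _ (q2 : ℝ) _ => K * (2 * q2) := by
  funext q1 p1 q2 p2
  simp [pdQ2, isoQuad, deriv_ofReal_sq]

theorem pdP2_isoQuad (K : ℂ) : pdP2 (isoQuad K) = fun _ _ _ (p2 : ℝ) => K * (2 * p2) := by
  funext q1 p1 q2 p2
  simp [pdP2, isoQuad, deriv_ofReal_sq]

theorem P1_isoQuad (K : ℂ) (G : PhaseFn) (q1 p1 q2 p2 : ℝ) :
    P1 (isoQuad K) G q1 p1 q2 p2 =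
      2 * K * (q1 * pdP1 G q1 p1 q2 p2 - p1 * pdQ1 G q1 p1 q2 p2 +
        (q2 * pdP2 G q1 p1 q2 p2 - p2 * pdQ2 G q1 p1 q2 p2)) := by
  simp only [P1, dQ, dP, Fin.sum_univ_two, Matrix.cons_val_zero, Matrix.cons_val_one,
    pdQ1_isoQuad, pdP1_isoQuad, pdQ2_isoQuad, pdP2_isoQuad]
  ring

theorem P2_isoQuad (K : ℂ) (G : PhaseFn) (q1 p1 q2 p2 : ℝ) :
    P2 (isoQuad K) G q1 p1 q2 p2 =
      2 * K * (pdP1 (pdP1 G) q1 p1 q2 p2 + pdQ1 (pdQ1 G) q1 p1 q2 p2 +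
        (pdP2 (pdP2 G) q1 p1 q2 p2 + pdQ2 (pdQ2 G) q1 p1 q2 p2)) := by
  have h11 : pdQ1 (fun q1 _ _ _ => K * (2 * q1)) q1 p1 q2 p2 = 2 * K := by
    simp [pdQ1, deriv_ofReal_id, mul_comm]
  have h22 : pdP1 (fun _ p1 _ _ => K * (2 * p1)) q1 p1 q2 p2 = 2 * K := by
    simp [pdP1, deriv_ofReal_id, mul_comm]
  have h33 : pdQ2 (fun _ _ q2 _ => K * (2 * q2)) q1 p1 q2 p2 = 2 * K := by
    simp [pdQ2, deriv_ofReal_id, mul_comm]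
  have h44 : pdP2 (fun _ _ _ p2 => K * (2 * p2)) q1 p1 q2 p2 = 2 * K := by
    simp [pdP2, deriv_ofReal_id, mul_comm]
  simp only [P2, dQ, dP, Fin.sum_univ_two, Matrix.cons_val_zero, Matrix.cons_val_one,
    pdQ1_isoQuad, pdP1_isoQuad, pdQ2_isoQuad, pdP2_isoQuad, h11, h22, h33, h44]
  simp only [pdQ1, pdQ2, pdP1, pdP2, deriv_const]
  ring

theorem hamiltonian_eq_isoQuad (ℏ Θ : ℝ) :
    (fun a b c d : ℝ =>
      H0 a b c d + HL ℏ Θ (-Θ) a b c d + Hq ℏ (-Θ) a b c d + Hpi ℏ Θ a b c d) =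
      isoQuad ((1 + (Θ : ℂ) ^ 2 / (4 * (ℏ : ℂ) ^ 2)) / 2) := by
  funext a b c d
  simp only [H0, HL, Hq, Hpi, isoQuad]
  push_cast
  ring

/-- if Θ̄ = −Θ then, for n₁ ≥ m₁ and n₂ ≥ m₂, the product state
`b⁴_{m,n}` is a right star-eigenfunction of the full Hamiltonian
`H = H₀ + H_L + H_q + H_π`:
`H ⋆ b⁴_{m,n} = ℏ(1 + Θ²/(4ℏ²))(m₁ + m₂ + 1) b⁴_{m,n}`. -/
theorem H_star_b4_of_theta_antisymmetric (ℏ Θ Θbar : ℝ) (hℏ : 0 < ℏ)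
    (hΘ : Θbar = -Θ) (m1 m2 n1 n2 : ℕ) (h1 : m1 ≤ n1) (h2 : m2 ≤ n2) :
    moyal ℏ
        (fun a b c d =>
          H0 a b c d + HL ℏ Θ Θbar a b c d + Hq ℏ Θbar a b c d + Hpi ℏ Θ a b c d)
        (b4 ℏ m1 n1 m2 n2) =
      fun q1 p1 q2 p2 =>
        (((ℏ * (1 + Θ ^ 2 / (4 * ℏ ^ 2)) : ℝ)) : ℂ) * ((m1 : ℂ) + (m2 : ℂ) + 1) *
          b4 ℏ m1 n1 m2 n2 q1 p1 q2 p2 := by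
  subst hΘ
  rw [hamiltonian_eq_isoQuad]
  funext q1 p1 q2 p2
  have e1 := oscillator_star_wignerF hℏ.ne' m1 n1 q1 p1
  have e2 := oscillator_star_wignerF hℏ.ne' m2 n2 q2 p2
  simp only [moyal, P1_isoQuad, P2_isoQuad]
  simp only [isoQuad, pdQ1, pdP1, pdQ2, pdP2, b4, deriv_mul_const_field, deriv_const_mul_field]
  push_cast
  linear_combination
    (1 + (Θ : ℂ) ^ 2 / (4 * (ℏ : ℂ) ^ 2)) * wignerF ℏ m2 n2 q2 p2 * e1 +
    (1 + (Θ : ℂ) ^ 2 / (4 * (ℏ : ℂ) ^ 2)) * wignerF ℏ m1 n1 q1 p1 * e2 +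
    (1 / 8 * (ℏ : ℂ) ^ 2 * (1 + (Θ : ℂ) ^ 2 / (4 * (ℏ : ℂ) ^ 2)) *
      ((deriv (fun s => deriv (fun t => wignerF ℏ m1 n1 q1 t) s) p1 +
        deriv (fun s => deriv (fun t => wignerF ℏ m1 n1 t p1) s) q1) * wignerF ℏ m2 n2 q2 p2 +
      wignerF ℏ m1 n1 q1 p1 * (deriv (fun s => deriv (fun t => wignerF ℏ m2 n2 q2 t) s) p2 +
        deriv (fun s => deriv (fun t => wignerF ℏ m2 n2 t p2) s) q2))) * Complex.I_sq
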